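/- (Lagarias) Let n ≥ 1 and let N be any norm on ℝⁿ (a function N : ℝⁿ → ℝ with N(x) = 0 iff x = 0, N(x+y) ≤ N(x)+N(y), and N(c·x) = |c|·N(x) for all c ∈ ℝ). Let α ∈ ℝⁿ have at least one irrational coordinate and let (q_k) be its sequence of best approximations with respect to N. Then for every k ≥ 1 one has q_{k+2^{n+1}} ≥ 2·q_{k+1} + q_k. -/

import Mathlib

open Filter

/-- The minimal `N`-distance from `m • α` to an integer vector in `ℝⁿ`. -/
noncomputable def bestDistN (n : ℕ) (N : (Fin n → ℝ) → ℝ) (α : Fin n → ℝ) (m : ℕ) : ℝ :=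
  ⨅ p : Fin n → ℤ, N ((m : ℝ) • α - fun i => (p i : ℝ))

/-- `q` (indexed from `1`) is the sequence of denominators of best simultaneous
Diophantine approximations to `α ∈ ℝⁿ` with respect to the norm `N`. -/
def IsBestApproxSeqN (n : ℕ) (N : (Fin n → ℝ) → ℝ) (α : Fin n → ℝ) (q : ℕ → ℕ) : Prop :=
  q 1 = 1 ∧
  (∀ k, 1 ≤ k → 0 < q k) ∧
  (∀ k, 1 ≤ k → q k < q (k + 1)) ∧
  (∀ k, 1 ≤ k → bestDistN n N α (q (k + 1)) < bestDistN n N α (q k)) ∧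
  (∀ k, 1 ≤ k → ∀ m : ℕ, 0 < m → m < q (k + 1) →
    bestDistN n N α (q k) ≤ bestDistN n N α m)

/-- Among `2 ^ (n + 1) + 1` integer vectors of dimension `n + 1`, two are congruent modulo `2`. -/
theorem exists_lt_congr_mod_two (n : ℕ) (a : ℕ → ℕ) (p : ℕ → Fin n → ℤ) :
    ∃ s t, s < t ∧ t ≤ 2 ^ (n + 1) ∧ (2 : ℤ) ∣ a t - a s ∧ ∀ i, (2 : ℤ) ∣ p t i - p s i := by
  let f : Fin (2 ^ (n + 1) + 1) → ZMod 2 × (Fin n → ZMod 2) :=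
    fun t => (((a t : ℤ) : ZMod 2), fun i => (p t i : ZMod 2))
  have hcard : Fintype.card (ZMod 2 × (Fin n → ZMod 2)) <
      Fintype.card (Fin (2 ^ (n + 1) + 1)) := by
    simp [ZMod.card, pow_succ, mul_comm]
  obtain ⟨s, t, hne, hst⟩ := Fintype.exists_ne_map_eq_of_card_lt f hcard
  wlog hlt : s < t generalizing s t
  · exact this t s hne.symm hst.symm (lt_of_le_of_ne (not_lt.mp hlt) hne.symm)
  refine ⟨s, t, hlt, Nat.lt_succ_iff.mp t.2, ?_, fun i => ?_⟩
  · exact (ZMod.intCast_eq_intCast_iff_dvd_sub _ _ 2).mp (congrArg Prod.fst hst)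
  · exact (ZMod.intCast_eq_intCast_iff_dvd_sub _ _ 2).mp (congrFun (congrArg Prod.snd hst) i)

/-- If two integer vectors `(a, p)` and `(a + 2 * m, p + 2 * r)` are congruent modulo `2`, then the
distance at half their difference is at most the mean of the distances. -/
theorem two_mul_bestDistN_le {n : ℕ} {N : (Fin n → ℝ) → ℝ}
    (hNadd : ∀ x y, N (x + y) ≤ N x + N y)
    (hNsmul : ∀ (c : ℝ) (x), N (c • x) = |c| * N x)
    (α : Fin n → ℝ) {a b m : ℕ} {p p' : Fin n → ℤ} (hab : b = a + 2 * m)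
    (hp : ∀ i, (2 : ℤ) ∣ p' i - p i) :
    2 * bestDistN n N α m ≤
      N ((a : ℝ) • α - fun i => (p i : ℝ)) + N ((b : ℝ) • α - fun i => (p' i : ℝ)) := by
  have hneg : ∀ x, N (-x) = N x := fun x => by simpa using hNsmul (-1) x
  have hnonneg : ∀ x, 0 ≤ N x := fun x => by
    have h0 : N 0 = 0 := by simpa using hNsmul 0 0
    have h := hNadd x (-x)
    rw [add_neg_cancel, h0, hneg] at h
    linarith
  choose r hr using hp
  have hle : bestDistN n N α m ≤ N ((m : ℝ) • α - fun i => (r i : ℝ)) :=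
    ciInf_le ⟨0, by rintro _ ⟨p, rfl⟩; exact hnonneg _⟩ r
  have hdiff : (2 : ℝ) • ((m : ℝ) • α - fun i => (r i : ℝ)) =
      -((a : ℝ) • α - fun i => (p i : ℝ)) + ((b : ℝ) • α - fun i => (p' i : ℝ)) := by
    ext i
    have hri : (p' i : ℝ) - p i = 2 * r i := by exact_mod_cast hr i
    simp only [Pi.smul_apply, Pi.sub_apply, Pi.add_apply, Pi.neg_apply, smul_eq_mul, hab]
    push_cast
    linear_combination hri
  have h2 := hNsmul 2 ((m : ℝ) • α - fun i => (r i : ℝ))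
  rw [hdiff, abs_two] at h2
  have h3 := hNadd (-((a : ℝ) • α - fun i => (p i : ℝ))) ((b : ℝ) • α - fun i => (p' i : ℝ))
  rw [hneg] at h3
  linarith

/-- **Lagarias' theorem.** For any norm `N` on `ℝⁿ` (`n ≥ 1`) and any `α` with at least
one irrational coordinate, the denominators of best approximations satisfy
`q (k + 2^(n+1)) ≥ 2 q (k+1) + q k` for all `k ≥ 1`. -/
theorem lagarias_best_approx (n : ℕ) (hn : 1 ≤ n) (N : (Fin n → ℝ) → ℝ)
    (hN0 : ∀ x, N x = 0 ↔ x = 0)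
    (hNadd : ∀ x y, N (x + y) ≤ N x + N y)
    (hNsmul : ∀ (c : ℝ) (x), N (c • x) = |c| * N x)
    (α : Fin n → ℝ) (hirr : ∃ i, Irrational (α i))
    (q : ℕ → ℕ) (hq : IsBestApproxSeqN n N α q) :
    ∀ k, 1 ≤ k → 2 * q (k + 1) + q k ≤ q (k + 2 ^ (n + 1)) := by
  obtain ⟨-, -, hqlt, hdlt, hbest⟩ := hq
  intro k hk
  have hqmono : StrictMono fun t => q (k + t) :=
    strictMono_nat_of_lt_succ fun t => hqlt (k + t) (by omega)
  have hdanti : StrictAnti fun t => bestDistN n N α (q (k + t)) :=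
    strictAnti_nat_of_succ_lt fun t => hdlt (k + t) (by omega)
  obtain ⟨t₀, -, ht₀⟩ := (Finset.range (2 ^ (n + 1) + 1)).exists_min_image
    (fun t => bestDistN n N α (q (k + t)) - bestDistN n N α (q (k + t + 1))) ⟨0, by simp⟩
  set ε := bestDistN n N α (q (k + t₀)) - bestDistN n N α (q (k + t₀ + 1))
  have hεpos : 0 < ε := sub_pos.mpr (hdlt (k + t₀) (by omega))
  have happrox : ∀ t, ∃ p : Fin n → ℤ, N ((q (k + t) : ℝ) • α - fun i => (p i : ℝ)) <
      bestDistN n N α (q (k + t)) + ε / 2 := fun t =>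
    exists_lt_of_ciInf_lt (lt_add_of_pos_right _ (half_pos hεpos))
  choose p hp using happrox
  obtain ⟨s, t, hst, ht, hqdvd, hpdvd⟩ := exists_lt_congr_mod_two n (fun t => q (k + t)) p
  have hqst : q (k + s) < q (k + t) := hqmono hst
  obtain ⟨m, hm⟩ : ∃ m, q (k + t) = q (k + s) + 2 * m :=
    ⟨(q (k + t) - q (k + s)) / 2, by omega⟩
  have hdist : bestDistN n N α m < bestDistN n N α (q (k + s)) := by
    have hmean := two_mul_bestDistN_le hNadd hNsmul α hm hpdvd
    have hgap : ε ≤ bestDistN n N α (q (k + s)) - bestDistN n N α (q (k + s + 1)) :=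
      ht₀ s (Finset.mem_range.mpr (by omega))
    have hdle : bestDistN n N α (q (k + t)) ≤ bestDistN n N α (q (k + s + 1)) := by
      have h := hdanti.antitone (show s + 1 ≤ t from hst)
      simpa only [add_assoc] using h
    linarith [hp s, hp t]
  have hqm : q (k + s + 1) ≤ m := by
    by_contra! hlt
    exact hdist.not_ge (hbest (k + s) (by omega) m (by omega) hlt)
  have hqk : q k ≤ q (k + s) := hqmono.monotone (Nat.zero_le s)
  have hqk1 : q (k + 1) ≤ q (k + s + 1) :=
    hqmono.monotone (show 1 ≤ s + 1 by omega)
  have hqt : q (k + t) ≤ q (k + 2 ^ (n + 1)) := hqmono.monotone ht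
  omega
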